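/- Let d ≥ 1, let V : ℤ^d → ℝ and E ∈ ℝ be such that A := 2d − 1 + sup_{x∈ℤ^d} |V(x) − E| < ∞. Let R ≥ 4 be an even integer, y ∈ ℤ^d, ε ≥ 0, and let ψ : Λ_R(y) → ℂ satisfy: (i) ψ(x) = 0 for every x ∈ Λ_R(y) with ‖x−y‖_∞ ∈ {R/2, R/2 − 1}; (ii) |−∑_{y'∈Λ_R(y), ‖x−y'‖₁=1} ψ(y') + (V(x) − E)ψ(x)| ≤ ε for every x ∈ Λ_R(y) with ‖x−y‖_∞ ≤ R/2 − 1. Then |ψ(x)| ≤ ε · (R/2 − 1) · A^{R/2 − 2} for all x ∈ Λ_R(y). -/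

import Mathlib

noncomputable section

/-- The discrete box `Λ_L(x₀) = {y ∈ ℤ^d : ‖y - x₀‖_∞ ≤ L/2}`, as a finite set.
(For an integer `k` one has `|k| ≤ L/2 ↔ |k| ≤ ⌊L/2⌋`.) -/
def boxZ (d : ℕ) (x₀ : Fin d → ℤ) (L : ℝ) : Finset (Fin d → ℤ) :=
  Fintype.piFinset fun i => Finset.Icc (x₀ i - ⌊L / 2⌋) (x₀ i + ⌊L / 2⌋)

end

/-- Two integer vectors at `ℓ¹` distance one differ by one in a single coordinate. -/
theorem exists_eq_update_of_sum_abs_sub_eq_one {ι : Type*} [Fintype ι] [DecidableEq ι]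
    {w z : ι → ℤ} (h : ∑ i, |w i - z i| = 1) :
    ∃ i, (z i = w i + 1 ∨ z i = w i - 1) ∧ z = Function.update w i (z i) := by
  obtain ⟨i, hi⟩ : ∃ i, w i - z i ≠ 0 := by
    by_contra! h0
    simp [h0] at h
  have hsum := Finset.add_sum_erase Finset.univ (fun i => |w i - z i|) (Finset.mem_univ i)
  rw [h] at hsum
  have hpos : 1 ≤ |w i - z i| := Int.one_le_abs hi
  have hrest : 0 ≤ ∑ j ∈ Finset.univ.erase i, |w j - z j| :=
    Finset.sum_nonneg fun _ _ => abs_nonneg _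
  have hrest0 : ∑ j ∈ Finset.univ.erase i, |w j - z j| = 0 := by
    omega
  have hone : |w i - z i| = 1 := by
    omega
  refine ⟨i, ?_, ?_⟩
  · rcases abs_eq (zero_le_one' ℤ) |>.1 hone with h1 | h1 <;> omega
  · ext j
    by_cases hj : j = i
    · subst hj
      simp
    · have hj0 := (Finset.sum_eq_zero_iff_of_nonneg fun _ _ => abs_nonneg _).1 hrest0 j
        (Finset.mem_erase.2 ⟨hj, Finset.mem_univ j⟩)
      rw [Function.update_of_ne hj]
      have := abs_eq_zero.1 hj0
      omega

/-- A set of lattice points at `ℓ¹` distance one from `w` has at most `2d` elements. -/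
theorem card_filter_sum_abs_sub_eq_one_le {ι : Type*} [Fintype ι] [DecidableEq ι]
    (s : Finset (ι → ℤ)) (w : ι → ℤ) :
    (s.filter fun z => (∑ i, |w i - z i|) = 1).card ≤ 2 * Fintype.card ι := by
  have hsub : (s.filter fun z => (∑ i, |w i - z i|) = 1) ⊆
      (Finset.univ : Finset (Bool × ι)).image fun p =>
        Function.update w p.2 (if p.1 then w p.2 + 1 else w p.2 - 1) := by
    intro z hz
    obtain ⟨i, hi, hzi⟩ := exists_eq_update_of_sum_abs_sub_eq_one (Finset.mem_filter.1 hz).2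
    rw [Finset.mem_image]
    rcases hi with hi | hi
    · exact ⟨(true, i), Finset.mem_univ _, by rw [hzi, hi]; simp⟩
    · exact ⟨(false, i), Finset.mem_univ _, by rw [hzi, hi]; simp⟩
  refine (Finset.card_le_card hsub).trans (Finset.card_image_le.trans ?_)
  simp [Fintype.card_prod]

theorem mem_boxZ_intCast_iff {d : ℕ} {y x : Fin d → ℤ} {r : ℤ} :
    x ∈ boxZ d y ((r + r : ℤ) : ℝ) ↔ ∀ i, |x i - y i| ≤ r := by
  have hfloor : ⌊((r + r : ℤ) : ℝ) / 2⌋ = r := by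
    push_cast
    rw [add_self_div_two, Int.floor_intCast]
  simp only [boxZ, hfloor, Fintype.mem_piFinset, Finset.mem_Icc, abs_le]
  exact forall_congr' fun i => by constructor <;> rintro ⟨h1, h2⟩ <;> constructor <;> omega

/-- The bound obtained by sweeping inwards from the face `σ (x i₀ - y i₀) = r` of the box. -/
theorem norm_le_geom_sum_of_sweep {d : ℕ} {V : (Fin d → ℤ) → ℝ} {E Winf : ℝ}
    (hW : ∀ x, |V x - E| ≤ Winf) {r : ℤ} {y : Fin d → ℤ} {ε : ℝ} (hε : 0 ≤ ε)
    {ψ : (Fin d → ℤ) → ℂ}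
    (hzero : ∀ x : Fin d → ℤ, (∀ i, |x i - y i| ≤ r) →
      (∃ i, r - 1 ≤ |x i - y i|) → ψ x = 0)
    (happrox : ∀ x : Fin d → ℤ, (∀ i, |x i - y i| ≤ r - 1) →
      ‖-(∑ z ∈ (boxZ d y ((r + r : ℤ) : ℝ)).filter (fun z => (∑ i, |x i - z i|) = 1), ψ z) +
          ((V x - E : ℝ) : ℂ) * ψ x‖ ≤ ε)
    (i₀ : Fin d) {σ : ℤ} (hσ : σ = 1 ∨ σ = -1) (k : ℕ) :
    ∀ x : Fin d → ℤ, (∀ i, |x i - y i| ≤ r) → r - 1 - k ≤ σ * (x i₀ - y i₀) →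
      ‖ψ x‖ ≤ ε * ∑ j ∈ Finset.range k, (2 * d - 1 + Winf) ^ j := by
  have hW0 : 0 ≤ Winf := (abs_nonneg _).trans (hW y)
  have hd1 : (1 : ℝ) ≤ d := by exact_mod_cast i₀.pos
  have hA : 0 ≤ 2 * (d : ℝ) - 1 + Winf := by linarith
  induction k with
  | zero =>
    intro x hx hxk
    have hle : σ * (x i₀ - y i₀) ≤ |x i₀ - y i₀| := by
      rcases hσ with rfl | rfl
      · simpa using le_abs_self (x i₀ - y i₀)
      · simpa using neg_le_abs (x i₀ - y i₀)
    rw [hzero x hx ⟨i₀, by push_cast at hxk; omega⟩]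
    simp
  | succ k ih =>
    intro x hx hxk
    set B := ε * ∑ j ∈ Finset.range k, (2 * (d : ℝ) - 1 + Winf) ^ j with hB
    have hB0 : 0 ≤ B := by positivity
    by_cases hbd : ∃ i, r - 1 ≤ |x i - y i|
    · rw [hzero x hx hbd, norm_zero]
      positivity
    push Not at hbd
    set w := Function.update x i₀ (x i₀ + σ) with hw
    have hw0 : w i₀ = x i₀ + σ := by simp [hw]
    have hwj : ∀ j, j ≠ i₀ → w j = x j := fun j hj => by simp [hw, hj]
    have hσσ : σ * σ = 1 := by rcases hσ with rfl | rfl <;> rfl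
    have hσabs : |σ| = 1 := by rcases hσ with rfl | rfl <;> rfl
    have hwbox : ∀ i, |w i - y i| ≤ r - 1 := by
      intro i
      have hi := hbd i
      by_cases h : i = i₀
      · subst h
        rw [hw0]
        have := abs_add_le (x i - y i) σ
        rw [show x i + σ - y i = x i - y i + σ by ring]
        omega
      · rw [hwj i h]
        omega
    have hxw : ∑ i, |w i - x i| = 1 := by
      rw [Finset.sum_eq_single i₀, hw0, add_sub_cancel_left, hσabs]
      · intro j _ hj
        simp [hwj j hj]
      · simp
    set S := (boxZ d y ((r + r : ℤ) : ℝ)).filter (fun z => (∑ i, |w i - z i|) = 1) with hS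
    have hxS : x ∈ S := Finset.mem_filter.2 ⟨mem_boxZ_intCast_iff.2 hx, hxw⟩
    have hψw : ‖ψ w‖ ≤ B := by
      refine ih w (fun i => (hwbox i).trans (by omega)) ?_
      rw [hw0, show σ * (x i₀ + σ - y i₀) = σ * (x i₀ - y i₀) + σ * σ by ring, hσσ]
      push_cast at hxk
      omega
    have hψz : ∀ z ∈ S.erase x, ‖ψ z‖ ≤ B := by
      intro z hz
      obtain ⟨hzx, hzS⟩ := Finset.mem_erase.1 hz
      obtain ⟨hzbox, hzw⟩ := Finset.mem_filter.1 hzS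
      refine ih z (mem_boxZ_intCast_iff.1 hzbox) ?_
      push_cast at hxk
      obtain ⟨i, hi, hzi⟩ := exists_eq_update_of_sum_abs_sub_eq_one hzw
      by_cases h : i = i₀
      · subst h
        have hne : z i ≠ x i := by
          intro hzxi
          apply hzx
          rw [hzi, hzxi, hw, Function.update_idem, Function.update_eq_self]
        rcases hσ with rfl | rfl <;> omega
      · have hz0 : z i₀ = w i₀ := by
          rw [hzi, Function.update_of_ne (Ne.symm h)]
        rcases hσ with rfl | rfl <;> omega
    have hcard : ((S.erase x).card : ℝ) ≤ 2 * d - 1 := by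
      have h1 := card_filter_sum_abs_sub_eq_one_le (boxZ d y ((r + r : ℤ) : ℝ)) w
      rw [← hS, ← Finset.card_erase_add_one hxS, Fintype.card_fin] at h1
      have h2 : ((S.erase x).card : ℝ) + 1 ≤ 2 * d := by exact_mod_cast h1
      linarith
    have hsum : ‖∑ z ∈ S.erase x, ψ z‖ ≤ (2 * d - 1) * B := by
      refine (norm_sum_le_of_le _ hψz).trans ?_
      rw [Finset.sum_const, nsmul_eq_mul]
      gcongr
    have hVw : ‖((V w - E : ℝ) : ℂ) * ψ w‖ ≤ Winf * B := by
      rw [norm_mul, Complex.norm_real, Real.norm_eq_abs]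
      exact mul_le_mul (hW w) hψw (norm_nonneg _) hW0
    have hψx : ψ x = ((V w - E : ℝ) : ℂ) * ψ w - ∑ z ∈ S.erase x, ψ z -
        (-(∑ z ∈ S, ψ z) + ((V w - E : ℝ) : ℂ) * ψ w) := by
      rw [← Finset.add_sum_erase S ψ hxS]
      ring
    calc ‖ψ x‖ ≤ ‖((V w - E : ℝ) : ℂ) * ψ w‖ + ‖∑ z ∈ S.erase x, ψ z‖ +
          ‖-(∑ z ∈ S, ψ z) + ((V w - E : ℝ) : ℂ) * ψ w‖ := by
          conv_lhs => rw [hψx]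
          exact (norm_sub_le _ _).trans (add_le_add_left (norm_sub_le _ _) _)
      _ ≤ Winf * B + (2 * d - 1) * B + ε := add_le_add (add_le_add hVw hsum) (happrox w hwbox)
      _ = ε * ∑ j ∈ Finset.range (k + 1), (2 * (d : ℝ) - 1 + Winf) ^ j := by
          rw [geom_sum_succ, hB]
          ring

/-- Discrete a priori bound: if `ψ` vanishes on the two outermost layers
of the box `Λ_R(y)` and `|(H-E)ψ| ≤ ε` at every `x ∈ Λ_R(y)` with `‖x-y‖_∞ ≤ R/2 - 1`,
then `|ψ(x)| ≤ ε (R/2 - 1) A^{R/2-2}` on all of `Λ_R(y)`, where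
`A = 2d - 1 + sup_x |V(x) - E|`. -/
theorem discrete_interior_bound (d : ℕ) (hd : 1 ≤ d)
    (V : (Fin d → ℤ) → ℝ) (E Winf : ℝ) (hW : ∀ x, |V x - E| ≤ Winf)
    (R : ℤ) (hR4 : 4 ≤ R) (hReven : Even R) (y : Fin d → ℤ)
    (ε : ℝ) (hε : 0 ≤ ε) (ψ : (Fin d → ℤ) → ℂ)
    (hzero : ∀ x : Fin d → ℤ, (∀ i, |x i - y i| ≤ R / 2) →
      (∃ i, R / 2 - 1 ≤ |x i - y i|) → ψ x = 0)
    (happrox : ∀ x : Fin d → ℤ, (∀ i, |x i - y i| ≤ R / 2 - 1) →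
      ‖-(∑ z ∈ (boxZ d y (R : ℝ)).filter (fun z => (∑ i, |x i - z i|) = 1), ψ z) +
          ((V x - E : ℝ) : ℂ) * ψ x‖ ≤ ε) :
    ∀ x : Fin d → ℤ, (∀ i, |x i - y i| ≤ R / 2) →
      ‖ψ x‖ ≤ ε * ((R : ℝ) / 2 - 1) * (2 * d - 1 + Winf) ^ (R / 2 - 2).toNat := by
  intro x hx
  obtain ⟨r, rfl⟩ := hReven
  have hr : (r + r) / 2 = r := by omega
  rw [hr] at hzero hx ⊢
  rw [hr] at happrox
  have hW0 : 0 ≤ Winf := (abs_nonneg _).trans (hW y)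
  have hd1 : (1 : ℝ) ≤ d := by exact_mod_cast hd
  obtain ⟨n, rfl⟩ : ∃ n : ℕ, r = n + 2 := ⟨(r - 2).toNat, by omega⟩
  let i₀ : Fin d := ⟨0, hd⟩
  have hbound : ‖ψ x‖ ≤ ε * ∑ j ∈ Finset.range (n + 1), (2 * (d : ℝ) - 1 + Winf) ^ j := by
    rcases le_total 0 (x i₀ - y i₀) with h | h
    · exact norm_le_geom_sum_of_sweep hW hε hzero happrox i₀ (Or.inl rfl) (n + 1) x hx
        (by push_cast; omega)
    · exact norm_le_geom_sum_of_sweep hW hε hzero happrox i₀ (Or.inr rfl) (n + 1) x hx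
        (by push_cast; omega)
  have hgeom : ∑ j ∈ Finset.range (n + 1), (2 * (d : ℝ) - 1 + Winf) ^ j ≤
      (n + 1 : ℕ) * (2 * (d : ℝ) - 1 + Winf) ^ n := by
    refine (Finset.sum_le_card_nsmul _ _ _ fun j hj => ?_).trans
      (by rw [Finset.card_range, nsmul_eq_mul])
    exact pow_le_pow_right₀ (by linarith) (Finset.mem_range_succ_iff.1 hj)
  refine hbound.trans ((mul_le_mul_of_nonneg_left hgeom hε).trans_eq ?_)
  rw [show ((n : ℤ) + 2 - 2).toNat = n by omega]
  push_cast
  ring
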